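/- Let P ⊆ ℝ^k be a k-dimensional polytope and f : P → ℝ a non-negative concave function. Suppose that for every line segment S ⊆ P the set Q_S = {(x, y) ∈ ℝ^k × ℝ : x ∈ S, 0 ≤ y ≤ f(x)} is a polytope (i.e., the convex hull of finitely many points). Then Q = {(x, y) : x ∈ P, 0 ≤ y ≤ f(x)} ⊆ ℝ^{k+1} is a polytope. -/

import Mathlib

/-- `f` lies below its chord on the segment from `a` to `a + w`. -/
def ChordAff {E : Type*} [AddCommGroup E] [Module ℝ E] (f : E → ℝ) (a w : E) : Prop :=
  ∀ s : ℝ, 0 ≤ s → s ≤ 1 → f (a + s • w) ≤ (1 - s) * f a + s * f (a + w)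

lemma conc_chord {E : Type*} [AddCommGroup E] [Module ℝ E] {K : Set E} {f : E → ℝ}
    (hf : ConcaveOn ℝ K f) {a w : E} (ha : a ∈ K) (hw : a + w ∈ K) {s : ℝ}
    (h0 : 0 ≤ s) (h1 : s ≤ 1) :
    a + s • w ∈ K ∧ (1 - s) * f a + s * f (a + w) ≤ f (a + s • w) := by
  have e : (1 - s) • a + s • (a + w) = a + s • w := by module
  have h := hf.2 ha hw (sub_nonneg.2 h1) h0 (by ring)
  have h' := hf.1 ha hw (sub_nonneg.2 h1) h0 (by ring)
  rw [e] at h h'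
  exact ⟨h', by simpa using h⟩

lemma ChordAff.scale {E : Type*} [AddCommGroup E] [Module ℝ E] {K : Set E} {f : E → ℝ}
    (hf : ConcaveOn ℝ K f) {a w : E} (ha : a ∈ K) (hw : a + w ∈ K) {r : ℝ}
    (h0 : 0 ≤ r) (h1 : r ≤ 1) (h : ChordAff f a w) : ChordAff f a (r • w) := by
  intro s hs0 hs1
  have h2 := h (s * r) (by positivity) (mul_le_one₀ hs1 h0 h1)
  have h3 := (conc_chord hf ha hw h0 h1).2
  have h4 := mul_le_mul_of_nonneg_left h3 hs0
  rw [smul_smul]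
  linarith

lemma ChordAff.triangle {E : Type*} [AddCommGroup E] [Module ℝ E] {K : Set E} {f : E → ℝ}
    (hf : ConcaveOn ℝ K f) {a v w : E} (ha : a ∈ K) (hv : a + v ∈ K)
    (hw : a + ((1/2 : ℝ) • v + w) ∈ K)
    (h1 : ChordAff f a v) (h2 : ChordAff f (a + (1/2 : ℝ) • v) w) :
    ChordAff f a ((1/2 : ℝ) • v + w) := by
  intro s hs0 hs1
  have hy := (conc_chord hf ha hw hs0 hs1).1
  set z := (1/2 : ℝ) • v + w with hz
  have hp : 0 < 2 - s := by linarith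
  have hm := h1 (1/2) (by norm_num) (by norm_num)
  have hq := h2 (s / (2 - s)) (by positivity) (by rw [div_le_one hp]; linarith)
  have e1 : a + (1/2 : ℝ) • v + w = a + z := by rw [hz]; abel
  rw [e1] at hq
  have hc := hf.2 hy hv (show 0 ≤ 1 / (2 - s) by positivity)
    (show 0 ≤ (1 - s) / (2 - s) from div_nonneg (by linarith) hp.le) (by field_simp; ring)
  have e2 : (1 / (2 - s)) • (a + s • z) + ((1 - s) / (2 - s)) • (a + v)
      = a + (1/2 : ℝ) • v + (s / (2 - s)) • w := by
    rw [hz]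
    match_scalars
    · field_simp; ring
    · field_simp; ring
    · field_simp
  rw [e2] at hc
  simp only [smul_eq_mul] at hc
  have h5 := hc.trans hq
  have h6 := mul_le_mul_of_nonneg_left h5 hp.le
  have e3 : (2 - s) * (1 / (2 - s) * f (a + s • z) + (1 - s) / (2 - s) * f (a + v))
     = f (a + s • z) + (1 - s) * f (a + v) := by field_simp
  have e4 : (2 - s) * ((1 - s / (2 - s)) * f (a + (1/2 : ℝ) • v) + s / (2 - s) * f (a + z))
     = (2 - 2 * s) * f (a + (1/2 : ℝ) • v) + s * f (a + z) := by field_simp; ring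
  rw [e3, e4] at h6
  have h7 := mul_le_mul_of_nonneg_left hm (show 0 ≤ 2 - 2 * s by linarith)
  linarith

lemma radial {E : Type*} [NormedAddCommGroup E] [NormedSpace ℝ E] [FiniteDimensional ℝ E]
    {K : Set E} {f : E → ℝ} (hf : ConcaveOn ℝ K f) (hK : IsClosed K)
    (hcone : ∀ a ∈ K, ∃ ε : ℝ, 0 < ε ∧ ∀ w : E, a + w ∈ K → ∀ s : ℝ, 0 ≤ s → ‖s • w‖ ≤ ε →
      a + s • w ∈ K)
    (hray : ∀ a ∈ K, ∀ w : E, a + w ∈ K → ∃ t : ℝ, 0 < t ∧ t ≤ 1 ∧ ChordAff f a (t • w))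
    (n : ℕ) : ∀ W : Submodule ℝ E, Module.finrank ℝ W ≤ n → ∀ a ∈ K, ∃ ε : ℝ, 0 < ε ∧
      ∀ w ∈ W, a + w ∈ K → ∀ s : ℝ, 0 ≤ s → ‖s • w‖ ≤ ε →
        a + s • w ∈ K ∧ ChordAff f a (s • w) := by
  induction n with
  | zero =>
    intro W hW a ha
    refine ⟨1, one_pos, ?_⟩
    intro w hw _ s _ _
    have : W = ⊥ := by
      apply Submodule.finrank_eq_zero.1; omega
    subst this
    rw [Submodule.mem_bot] at hw
    subst hw
    refine ⟨by simpa using ha, ?_⟩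
    intro r _ _
    simp only [smul_zero, add_zero]
    linarith
  | succ n ih =>
    intro W hW a ha
    obtain ⟨ε, hε, hc⟩ := hcone a ha
    set D : Set E := {u | u ∈ W ∧ ‖u‖ = ε ∧ a + u ∈ K} with hD
    have hDc : IsCompact D := by
      have h1 : IsCompact (Metric.sphere (0:E) ε) := isCompact_sphere _ _
      have h2 : IsClosed ((W : Set E) ∩ {u | a + u ∈ K}) :=
        (W.closed_of_finiteDimensional).inter (hK.preimage (by fun_prop))
      convert h1.inter_right h2 using 1
      ext u
      simp [hD]; tauto
    have key : ∃ δ : ℝ, 0 < δ ∧ δ ≤ 1 ∧ ∀ u ∈ D, ChordAff f a (δ • u) := by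
      have := hDc.induction_on (p := fun S => ∃ δ : ℝ, 0 < δ ∧ δ ≤ 1 ∧
        ∀ u ∈ S ∩ D, ChordAff f a (δ • u)) ?_ ?_ ?_ ?_
      · simpa using this
      · exact ⟨1, one_pos, le_rfl, by simp⟩
      · rintro S T hST ⟨δ, h0, h1, h2⟩
        exact ⟨δ, h0, h1, fun u hu => h2 u ⟨hST hu.1, hu.2⟩⟩
      · rintro S T ⟨δ, h0, h1, h2⟩ ⟨δ', h0', h1', h2'⟩
        have aux : ∀ δ δ' : ℝ, 0 < δ → δ ≤ 1 → 0 < δ' → δ' ≤ δ → ∀ u ∈ D,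
            ChordAff f a (δ • u) → ChordAff f a (δ' • u) := by
          intro δ δ' h0 h1 h0' hle u hu h
          have := ChordAff.scale hf ha (conc_chord hf ha hu.2.2 h0.le h1).1
            (r := δ' / δ) (by positivity) ((div_le_one h0).2 hle) h
          rwa [smul_smul, div_mul_cancel₀ _ h0.ne'] at this
        refine ⟨min δ δ', lt_min h0 h0', (min_le_left _ _).trans h1, ?_⟩
        rintro u ⟨hu | hu, huD⟩
        · exact aux δ _ h0 h1 (lt_min h0 h0') (min_le_left _ _) u huD (h2 u ⟨hu, huD⟩)
        · exact aux δ' _ h0' h1' (lt_min h0 h0') (min_le_right _ _) u huD (h2' u ⟨hu, huD⟩)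
      · intro v hv
        obtain ⟨hvW, hvn, hvK⟩ := hv
        obtain ⟨t, ht0, ht1, htA⟩ := hray a ha v hvK
        have hv0 : v ≠ 0 := by
          rintro rfl; simp at hvn; linarith
        obtain ⟨φ, hφ⟩ := SeparatingDual.exists_eq_one (R := ℝ) hv0
        set W' : Submodule ℝ E := W ⊓ LinearMap.ker (φ : E →ₗ[ℝ] ℝ) with hW'
        have hlt : W' < W := by
          refine lt_of_le_of_ne inf_le_left ?_
          intro h
          have : v ∈ W' := h ▸ hvW
          have : φ v = 0 := by simpa using this.2
          rw [hφ] at this; norm_num at this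
        have hfin : Module.finrank ℝ W' ≤ n := by
          have := Submodule.finrank_lt_finrank_of_lt hlt
          omega
        have htK : a + t • v ∈ K := (conc_chord hf ha hvK ht0.le ht1).1
        have hxK : a + (1/2 : ℝ) • (t • v) ∈ K :=
          (conc_chord hf ha htK (by norm_num) (by norm_num)).1
        obtain ⟨η, hη, hη'⟩ := ih W' hfin _ hxK
        have hφc : ContinuousAt (fun u => φ u) v := φ.continuous.continuousAt
        have hcont : ContinuousAt (fun u => ‖(t / 2 / φ u) • u - (1/2 : ℝ) • (t • v)‖) v := by
          apply ContinuousAt.norm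
          refine ContinuousAt.sub (ContinuousAt.smul (ContinuousAt.div continuousAt_const hφc ?_)
            continuousAt_id) continuousAt_const
          rw [hφ]; norm_num
        have ev1 : ∀ᶠ u in nhds v, ‖(t / 2 / φ u) • u - (1/2 : ℝ) • (t • v)‖ < η := by
          apply hcont.eventually_lt_const
          have : (t / 2 / φ v) • v - (1/2 : ℝ) • (t • v) = 0 := by
            rw [hφ]; module
          simp only [this]; simpa using hη
        have ev2 : ∀ᶠ u in nhds v, φ u < 2 := hφc.eventually_lt_const (by simp only [hφ]; norm_num)
        have ev3 : ∀ᶠ u in nhds v, 1/2 < φ u := hφc.eventually_const_lt (by simp only [hφ]; norm_num)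
        refine ⟨_, mem_nhdsWithin_of_mem_nhds (ev1.and (ev2.and ev3)), t / 4, by positivity,
          by linarith, ?_⟩
        rintro u ⟨⟨g1, g2, g3⟩, huW, hun, huK⟩
        have hpos : 0 < φ u := by linarith
        have hz1 : t / 2 / φ u ≤ 1 := by rw [div_le_one hpos]; linarith
        have hz0 : 0 ≤ t / 2 / φ u := by positivity
        have hzK := (conc_chord hf ha huK hz0 hz1).1
        set w := (t / 2 / φ u) • u - (1/2 : ℝ) • (t • v) with hw
        have e : (t / 2 / φ u) • u = (1/2 : ℝ) • (t • v) + w := by rw [hw]; abel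
        have hwW : w ∈ W' := by
          refine ⟨W.sub_mem (W.smul_mem _ huW) (W.smul_mem _ (W.smul_mem _ hvW)), ?_⟩
          simp only [SetLike.mem_coe, LinearMap.mem_ker, ContinuousLinearMap.coe_coe, hw, map_sub,
            map_smul, smul_eq_mul, hφ]
          field_simp; ring
        have hA := hη' w hwW (by rw [add_assoc, ← e]; exact hzK) 1 zero_le_one
          (by rw [one_smul]; exact g1.le)
        rw [one_smul] at hA
        have hT := ChordAff.triangle hf ha htK (by rw [← e]; exact hzK) htA hA.2
        rw [← e] at hT
        have := ChordAff.scale hf ha hzK (r := φ u / 2) (by positivity) (by linarith) hT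
        rw [smul_smul] at this
        convert this using 2
        field_simp; ring
    obtain ⟨δ, hδ0, hδ1, hδ⟩ := key
    refine ⟨δ * ε, by positivity, ?_⟩
    intro w hw hwK s hs hsn
    have hK' := hc w hwK s hs (hsn.trans (by nlinarith))
    refine ⟨hK', ?_⟩
    by_cases h0 : w = 0
    · subst h0
      intro r _ _
      simp only [smul_zero, add_zero]
      linarith
    have hwn : 0 < ‖w‖ := norm_pos_iff.2 h0
    have hnorm : ‖(ε / ‖w‖) • w‖ = ε := by
      rw [norm_smul, Real.norm_of_nonneg (by positivity)]; field_simp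
    have huD : (ε / ‖w‖) • w ∈ D :=
      ⟨W.smul_mem _ hw, hnorm, hc w hwK _ (by positivity) hnorm.le⟩
    have h1 := hδ _ huD
    rw [norm_smul, Real.norm_of_nonneg hs] at hsn
    have := ChordAff.scale hf ha (conc_chord hf ha huD.2.2 hδ0.le hδ1).1
      (r := s * ‖w‖ / (δ * ε)) (by positivity) ((div_le_one (by positivity)).2 hsn) h1
    rw [smul_smul, smul_smul] at this
    convert this using 2
    field_simp

lemma ray_of_seg {E : Type*} [AddCommGroup E] [Module ℝ E] {f : E → ℝ} (a b : E)
    (ha0 : 0 ≤ f a) (hb0 : 0 ≤ f b)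
    (hf0 : ∀ x ∈ segment ℝ a b, 0 ≤ f x)
    (G : Finset (E × ℝ))
    (hG : {p : E × ℝ | p.1 ∈ segment ℝ a b ∧ 0 ≤ p.2 ∧ p.2 ≤ f p.1} = convexHull ℝ (↑G : Set (E × ℝ))) :
    ∃ t : ℝ, 0 < t ∧ t ≤ 1 ∧ ChordAff f a (t • (b - a)) := by
  by_cases hab : b - a = 0
  · refine ⟨1, one_pos, le_rfl, ?_⟩
    intro s _ _
    simp only [hab, smul_zero, add_zero]
    linarith
  have hmem : ∀ g ∈ G, ∃ s : ℝ, 0 ≤ s ∧ s ≤ 1 ∧ g.1 = a + s • (b - a) ∧ g.2 ≤ f g.1 := by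
    intro g hg
    have : g ∈ convexHull ℝ (↑G : Set (E × ℝ)) := subset_convexHull _ _ hg
    rw [← hG] at this
    obtain ⟨h1, h2, h3⟩ := this
    rw [segment_eq_image'] at h1
    obtain ⟨s, hs, h⟩ := h1
    exact ⟨s, hs.1, hs.2, h.symm, h3⟩
  choose! σ hσ0 hσ1 hσ hσf using hmem
  have hconv : ∀ m c : ℝ, Convex ℝ {p : E × ℝ | ∃ s : ℝ, p.1 = a + s • (b - a) ∧ p.2 ≤ c + m * s} := by
    rintro m c p ⟨s, hs, hs'⟩ q ⟨r, hr, hr'⟩ α β hα hβ h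
    refine ⟨α * s + β * r, ?_, ?_⟩
    · simp only [Prod.fst_add, Prod.smul_fst, hs, hr]
      have : α = 1 - β := by linarith
      subst this
      module
    · simp only [Prod.snd_add, Prod.smul_snd, smul_eq_mul]
      have : α = 1 - β := by linarith
      subst this
      nlinarith [mul_le_mul_of_nonneg_left hs' hα, mul_le_mul_of_nonneg_left hr' hβ]
  have hinj : ∀ s r : ℝ, a + s • (b - a) = a + r • (b - a) → s = r := by
    intro s r h
    exact smul_left_injective ℝ hab (add_left_cancel h)
  classical
  have hne : (G.filter (fun g => 0 < σ g)).Nonempty := by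
    by_contra hcon
    rw [Finset.not_nonempty_iff_eq_empty, Finset.filter_eq_empty_iff] at hcon
    have hsub : convexHull ℝ (↑G : Set (E × ℝ)) ⊆ {p : E × ℝ | p.1 = a} := by
      apply convexHull_min
      · intro g hg
        have h1 : σ g = 0 := le_antisymm (not_lt.1 (hcon hg)) (hσ0 g hg)
        have h2 := hσ g hg
        rw [h1] at h2
        simpa using h2
      · have : {p : E × ℝ | p.1 = a} = (LinearMap.fst ℝ E ℝ) ⁻¹' {a} := rfl
        rw [this]
        exact (convex_singleton a).linear_preimage _
    have hb : (b, f b) ∈ convexHull ℝ (↑G : Set (E × ℝ)) := by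
      rw [← hG]; exact ⟨right_mem_segment _ _ _, hb0, le_rfl⟩
    have : b = a := hsub hb
    exact hab (by rw [this, sub_self])
  obtain ⟨g, hg, hmax⟩ := Finset.exists_max_image _ (fun g : E × ℝ => (g.2 - f a) / σ g) hne
  rw [Finset.mem_filter] at hg
  obtain ⟨hgG, hgpos⟩ := hg
  set m := (g.2 - f a) / σ g with hm
  have hsub : convexHull ℝ (↑G : Set (E × ℝ)) ⊆
      {p : E × ℝ | ∃ s : ℝ, p.1 = a + s • (b - a) ∧ p.2 ≤ f a + m * s} := by
    apply convexHull_min _ (hconv m (f a))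
    intro q hq
    refine ⟨σ q, hσ q hq, ?_⟩
    rcases (hσ0 q hq).eq_or_lt with h | h
    · have h2 := hσf q hq
      rw [hσ q hq] at h2
      rw [← h] at h2 ⊢
      simpa using h2
    · have := hmax q (Finset.mem_filter.2 ⟨hq, h⟩)
      rw [div_le_iff₀ h] at this
      linarith
  have hbound : ∀ s : ℝ, 0 ≤ s → s ≤ 1 → f (a + s • (b - a)) ≤ f a + m * s := by
    intro s h0 h1
    have hs : a + s • (b - a) ∈ segment ℝ a b := by
      rw [segment_eq_image']; exact ⟨s, ⟨h0, h1⟩, rfl⟩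
    have : (a + s • (b - a), f (a + s • (b - a))) ∈ convexHull ℝ (↑G : Set (E × ℝ)) := by
      rw [← hG]; exact ⟨hs, hf0 _ hs, le_rfl⟩
    obtain ⟨r, hr, hr'⟩ := hsub this
    have := hinj _ _ hr
    subst this
    exact hr'
  refine ⟨σ g, hgpos, hσ1 g hgG, ?_⟩
  intro s h0 h1
  have h2 := hbound (s * σ g) (by positivity) (mul_le_one₀ h1 hgpos.le (hσ1 g hgG))
  have h3 := hσf g hgG
  rw [hσ g hgG] at h3
  have h4 : m * σ g = g.2 - f a := by rw [hm]; field_simp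
  rw [smul_smul]
  have h5 := mul_le_mul_of_nonneg_left h3 h0
  have : m * (s * σ g) = s * (g.2 - f a) := by rw [← h4]; ring
  linarith

lemma simplex_cone {ι : Type*} [Fintype ι] (a : ι → ℝ) (ha : a ∈ stdSimplex ℝ ι) :
    ∃ ε : ℝ, 0 < ε ∧ ∀ w : ι → ℝ, a + w ∈ stdSimplex ℝ ι → ∀ s : ℝ, 0 ≤ s → ‖s • w‖ ≤ ε →
      a + s • w ∈ stdSimplex ℝ ι := by
  have : ∃ ε : ℝ, 0 < ε ∧ ∀ i, 0 < a i → ε ≤ a i := by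
    by_cases h : (Finset.univ.filter (fun i => 0 < a i)).Nonempty
    · obtain ⟨i, hi, hmin⟩ := Finset.exists_min_image _ a h
      exact ⟨a i, (Finset.mem_filter.1 hi).2, fun j hj => hmin j (by simp [hj])⟩
    · refine ⟨1, one_pos, fun i hi => (h ⟨i, by simp [hi]⟩).elim⟩
  obtain ⟨ε, h0, h⟩ := this
  refine ⟨ε, h0, fun w hw s hs hn => ⟨fun i => ?_, ?_⟩⟩
  · have hi := norm_le_pi_norm (s • w) i
    have h1 := hw.1 i
    simp only [Pi.add_apply, Pi.smul_apply, smul_eq_mul, Real.norm_eq_abs] at *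
    rcases (ha.1 i).eq_or_lt with h2 | h2
    · rw [← h2] at h1 ⊢
      have : 0 ≤ w i := by linarith
      positivity
    · have := h i h2
      have := neg_abs_le (s * w i)
      linarith
  · have h1 := hw.2
    have h2 := ha.2
    simp only [Pi.add_apply, Pi.smul_apply, smul_eq_mul, Finset.sum_add_distrib,
      ← Finset.mul_sum] at *
    rw [h2] at h1 ⊢
    have : ∑ i, w i = 0 := by linarith
    rw [this]; ring

lemma simplex_bound {ι : Type*} [Fintype ι] {f : (ι → ℝ) → ℝ}
    (hf : ConcaveOn ℝ (stdSimplex ℝ ι) f) (hf0 : ∀ x ∈ stdSimplex ℝ ι, 0 ≤ f x) :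
    ∃ B : ℝ, 0 ≤ B ∧ ∀ x ∈ stdSimplex ℝ ι, f x ≤ B := by
  rcases isEmpty_or_nonempty ι with hι | hι
  · refine ⟨0, le_rfl, fun x hx => ?_⟩
    have := hx.2
    simp at this
  have hN : (0 : ℝ) < Fintype.card ι := by exact_mod_cast Fintype.card_pos
  set τ : ℝ := 1 / Fintype.card ι with hτ
  have hτ0 : 0 < τ := by positivity
  set c : ι → ℝ := fun _ => τ with hc
  have hcs : ∑ i, c i = 1 := by simp [hc, hτ]
  have hcK : c ∈ stdSimplex ℝ ι := ⟨fun i => hτ0.le, hcs⟩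
  refine ⟨(1 + τ) / τ * f c, mul_nonneg (by positivity) (hf0 _ hcK), fun x hx => ?_⟩
  have hx' : c - τ • (x - c) ∈ stdSimplex ℝ ι := by
    refine ⟨fun i => ?_, ?_⟩
    · have h1 : x i ≤ 1 := by
        rw [← hx.2]; exact Finset.single_le_sum (fun j _ => hx.1 j) (Finset.mem_univ i)
      simp only [Pi.sub_apply, Pi.smul_apply, smul_eq_mul, hc]
      nlinarith
    · simp only [Pi.sub_apply, Pi.smul_apply, smul_eq_mul, Finset.sum_sub_distrib,
        ← Finset.mul_sum, hcs, hx.2]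
      ring
  have h := hf.2 hx' hx (show 0 ≤ 1 / (1 + τ) by positivity)
    (show 0 ≤ τ / (1 + τ) by positivity)
    (by field_simp)
  have e : (1 / (1 + τ)) • (c - τ • (x - c)) + (τ / (1 + τ)) • x = c := by
    match_scalars
    · field_simp; ring
    · field_simp; ring
  rw [e] at h
  simp only [smul_eq_mul] at h
  have h2 : 0 ≤ 1 / (1 + τ) * f (c - τ • (x - c)) := mul_nonneg (by positivity) (hf0 _ hx')
  have h3 : τ / (1 + τ) * f x ≤ f c := by linarith
  have h4 := mul_le_mul_of_nonneg_left h3 (show 0 ≤ (1 + τ) / τ by positivity)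
  have e2 : (1 + τ) / τ * (τ / (1 + τ) * f x) = f x := by field_simp
  linarith

lemma hypo_polytope {E : Type*} [NormedAddCommGroup E] [NormedSpace ℝ E]
    {K : Set E} {f : E → ℝ} (hf : ConcaveOn ℝ K f) (hK : IsCompact K)
    (hf0 : ∀ x ∈ K, 0 ≤ f x) (B : ℝ) (hB0 : 0 ≤ B) (hB : ∀ x ∈ K, f x ≤ B)
    (hrad : ∀ a ∈ K, ∃ ε : ℝ, 0 < ε ∧
      ∀ w : E, a + w ∈ K → ∀ s : ℝ, 0 ≤ s → ‖s • w‖ ≤ ε →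
        a + s • w ∈ K ∧ ChordAff f a (s • w)) :
    ∃ G : Finset (E × ℝ), {p : E × ℝ | p.1 ∈ K ∧ 0 ≤ p.2 ∧ p.2 ≤ f p.1}
      = convexHull ℝ (↑G : Set (E × ℝ)) := by
  set Q := {p : E × ℝ | p.1 ∈ K ∧ 0 ≤ p.2 ∧ p.2 ≤ f p.1} with hQ
  have husc : ∀ a ∈ K, ∃ ε : ℝ, 0 < ε ∧ ∀ x ∈ K, ‖x - a‖ < ε → f x ≤ f a + ‖x - a‖ / ε * B := by
    intro a ha
    obtain ⟨ε, hε, h⟩ := hrad a ha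
    refine ⟨ε, hε, fun x hx hxa => ?_⟩
    by_cases h0 : x - a = 0
    · rw [h0, sub_eq_zero.1 h0]; simp
    have hn : 0 < ‖x - a‖ := norm_pos_iff.2 h0
    have h1 := h (x - a) (by simpa using hx) (ε / ‖x - a‖) (by positivity)
      (by rw [norm_smul, Real.norm_of_nonneg (by positivity)]; field_simp; exact le_rfl)
    have h2 := h1.2 (‖x - a‖ / ε) (by positivity) ((div_le_one hε).2 hxa.le)
    have e : a + (‖x - a‖ / ε) • (ε / ‖x - a‖) • (x - a) = x := by
      rw [smul_smul]
      have : ‖x - a‖ / ε * (ε / ‖x - a‖) = 1 := by field_simp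
      rw [this]; simp
    rw [e] at h2
    have h3 : 0 ≤ ‖x - a‖ / ε := by positivity
    have h4 := mul_le_mul_of_nonneg_left (hB _ h1.1) h3
    have h5 := mul_nonneg h3 (hf0 a ha)
    linarith
  have hQcl : IsClosed Q := by
    apply IsSeqClosed.isClosed
    intro u p hu hlim
    have h1 : Filter.Tendsto (fun n => (u n).1) Filter.atTop (nhds p.1) :=
      (continuous_fst.tendsto p).comp hlim
    have h2 : Filter.Tendsto (fun n => (u n).2) Filter.atTop (nhds p.2) :=
      (continuous_snd.tendsto p).comp hlim
    have hp1 : p.1 ∈ K := hK.isClosed.mem_of_tendsto h1 (Filter.Eventually.of_forall fun n => (hu n).1)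
    refine ⟨hp1, ge_of_tendsto' h2 (fun n => (hu n).2.1), ?_⟩
    obtain ⟨ε, hε, h⟩ := husc _ hp1
    have h3 : Filter.Tendsto (fun n => ‖(u n).1 - p.1‖) Filter.atTop (nhds 0) := by
      have := (h1.sub_const p.1).norm
      simpa using this
    have h4 : Filter.Tendsto (fun n => f p.1 + ‖(u n).1 - p.1‖ / ε * B) Filter.atTop
        (nhds (f p.1)) := by
      have := ((h3.div_const ε).mul_const B).const_add (f p.1)
      simpa using this
    refine le_of_tendsto_of_tendsto h2 h4 ?_
    filter_upwards [h3.eventually_lt_const hε] with n hn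
    exact (hu n).2.2.trans (h _ (hu n).1 hn)
  have hQc : IsCompact Q := by
    refine (hK.prod (isCompact_Icc (a := (0:ℝ)) (b := B))).of_isClosed_subset hQcl ?_
    rintro p ⟨h1, h2, h3⟩
    exact ⟨h1, h2, h3.trans (hB _ h1)⟩
  have hQconv : Convex ℝ Q := by
    rintro p ⟨h1, h2, h3⟩ q ⟨g1, g2, g3⟩ α β hα hβ hαβ
    refine ⟨hf.1 h1 g1 hα hβ hαβ, ?_, ?_⟩
    · simp only [Prod.snd_add, Prod.smul_snd, smul_eq_mul]; positivity
    · have := hf.2 h1 g1 hα hβ hαβ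
      simp only [Prod.snd_add, Prod.smul_snd, smul_eq_mul, Prod.fst_add, Prod.smul_fst] at *
      exact le_trans (by gcongr) this
  have hfin : (Q.extremePoints ℝ).Finite := by
    have := hK.induction_on (p := fun S => (Q.extremePoints ℝ ∩ Prod.fst ⁻¹' S).Finite) ?_ ?_ ?_ ?_
    · refine this.subset fun p hp => ⟨hp, hp.1.1⟩
    · simp
    · intro S T hST h
      exact h.subset (by gcongr)
    · intro S T hS hT
      rw [Set.preimage_union, Set.inter_union_distrib_left]
      exact hS.union hT
    · intro a ha
      obtain ⟨ε, hε, h⟩ := hrad a ha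
      refine ⟨Metric.ball a (ε / 2), mem_nhdsWithin_of_mem_nhds (Metric.ball_mem_nhds _ (by positivity)), ?_⟩
      refine (Set.toFinite {(a, (0:ℝ)), (a, f a)}).subset ?_
      rintro ⟨x, y⟩ ⟨hp, hx⟩
      obtain ⟨⟨hxK, hy0, hyf⟩, hext⟩ := hp
      simp only at hxK hy0 hyf
      simp only [Set.mem_preimage, mem_ball_iff_norm] at hx
      have hc : ∃ c : ℝ, 0 ≤ c ∧ c ≤ 1 ∧ y = c * f x := by
        rcases (hf0 x hxK).eq_or_lt with h0 | h0
        · exact ⟨0, le_rfl, zero_le_one, by linarith⟩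
        · exact ⟨y / f x, by positivity, (div_le_one h0).2 hyf, by field_simp⟩
      obtain ⟨c, hc0, hc1, rfl⟩ := hc
      by_cases hxa : x = a
      · subst hxa
        by_cases hcc : c = 0
        · left; simp [hcc]
        by_cases hcc' : c = 1
        · right; simp [hcc']
        left
        have := hext (x₁ := (x, 0)) ⟨hxK, le_rfl, hf0 x hxK⟩ (x₂ := (x, f x))
          ⟨hxK, hf0 x hxK, le_rfl⟩
          ⟨1 - c, c, sub_pos.2 (lt_of_le_of_ne hc1 hcc'), lt_of_le_of_ne hc0 (Ne.symm hcc), by ring,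
            by ext
               · simp only [Prod.fst_add, Prod.smul_fst]; module
               · simp⟩
        exact this.symm
      · exfalso
        have h1 := h (x - a) (by simpa using hxK) 2 (by norm_num)
          (by rw [norm_smul, Real.norm_of_nonneg (by norm_num)]; linarith)
        have h2 := h1.2 (1/2) (by norm_num) (by norm_num)
        have h3 := (conc_chord hf ha h1.1 (s := 1/2) (by norm_num) (by norm_num)).2
        have e : a + (1/2 : ℝ) • (2 : ℝ) • (x - a) = x := by module
        rw [e] at h2 h3
        set z := a + (2 : ℝ) • (x - a) with hz
        have h4 : f x = (1 - 1/2) * f a + 1/2 * f z := le_antisymm h2 h3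
        have ga := hf0 a ha
        have gz := hf0 z h1.1
        have := hext (x₁ := (a, c * f a)) ⟨ha, mul_nonneg hc0 ga, by
            simp only; nlinarith⟩ (x₂ := (z, c * f z)) ⟨h1.1, mul_nonneg hc0 gz, by
            simp only; nlinarith⟩
          ⟨1/2, 1/2, by norm_num, by norm_num, by norm_num,
            by ext
               · simp only [Prod.fst_add, Prod.smul_fst, hz]; module
               · simp only [Prod.snd_add, Prod.smul_snd, smul_eq_mul, h4]; ring⟩
        exact hxa (congrArg Prod.fst this).symm
  refine ⟨hfin.toFinset, ?_⟩
  rw [Set.Finite.coe_toFinset]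
  conv_lhs => rw [← closure_convexHull_extremePoints hQc hQconv]
  exact (hfin.isClosed_convexHull ℝ).closure_eq

theorem fibered_polytope_is_polytope
    (k : ℕ) (P : Set (Fin k → ℝ)) (F : Finset (Fin k → ℝ))
    (hP : P = convexHull ℝ (↑F : Set (Fin k → ℝ)))
    (hdim : affineSpan ℝ P = ⊤)
    (f : (Fin k → ℝ) → ℝ) (hf0 : ∀ x ∈ P, 0 ≤ f x)
    (hconc : ConcaveOn ℝ P f)
    (hseg : ∀ a ∈ P, ∀ b ∈ P, ∃ G : Finset ((Fin k → ℝ) × ℝ),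
      {p : (Fin k → ℝ) × ℝ | p.1 ∈ segment ℝ a b ∧ 0 ≤ p.2 ∧ p.2 ≤ f p.1}
        = convexHull ℝ (↑G : Set ((Fin k → ℝ) × ℝ))) :
    ∃ G : Finset ((Fin k → ℝ) × ℝ),
      {p : (Fin k → ℝ) × ℝ | p.1 ∈ P ∧ 0 ≤ p.2 ∧ p.2 ≤ f p.1}
        = convexHull ℝ (↑G : Set ((Fin k → ℝ) × ℝ)) := by
  classical
  set L : ((↑F : Set (Fin k → ℝ)) → ℝ) →ₗ[ℝ] (Fin k → ℝ) :=
    ∑ x : (↑F : Set (Fin k → ℝ)), (LinearMap.proj (R := ℝ) x).smulRight x.1 with hL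
  have hPL : P = L '' stdSimplex ℝ (↑F : Set (Fin k → ℝ)) := by
    rw [hP, (F.finite_toSet).convexHull_eq_image]
    congr!
  set K := stdSimplex ℝ (↑F : Set (Fin k → ℝ)) with hK
  have hLP : ∀ x ∈ K, L x ∈ P := fun x hx => by rw [hPL]; exact ⟨x, hx, rfl⟩
  have hKconv : Convex ℝ K := convex_stdSimplex _ _
  have hfL : ConcaveOn ℝ K (f ∘ L) := by
    refine (hconc.comp_linearMap L).subset ?_ hKconv
    exact hLP
  have hfL0 : ∀ x ∈ K, 0 ≤ (f ∘ L) x := fun x hx => hf0 _ (hLP x hx)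
  have hKc : IsCompact K := isCompact_stdSimplex ℝ _
  obtain ⟨B, hB0, hB⟩ := simplex_bound hfL hfL0
  have hray : ∀ a ∈ K, ∀ w, a + w ∈ K →
      ∃ t : ℝ, 0 < t ∧ t ≤ 1 ∧ ChordAff (f ∘ L) a (t • w) := by
    intro a ha w hw
    obtain ⟨G, hG⟩ := hseg _ (hLP a ha) _ (hLP _ hw)
    have hPc : Convex ℝ P := hconc.1
    obtain ⟨t, h0, h1, h2⟩ := ray_of_seg (L a) (L (a + w)) (hfL0 a ha) (hfL0 _ hw)
      (fun x hx => hf0 x (hPc.segment_subset (hLP a ha) (hLP _ hw) hx)) G hG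
    refine ⟨t, h0, h1, fun s hs0 hs1 => ?_⟩
    have := h2 s hs0 hs1
    simpa using this
  obtain ⟨G, hG⟩ := hypo_polytope hfL hKc hfL0 B hB0 hB (by
    intro a ha
    obtain ⟨ε, hε, h⟩ := radial hfL hKc.isClosed simplex_cone hray _ ⊤ le_rfl a ha
    exact ⟨ε, hε, fun w => h w Submodule.mem_top⟩)
  refine ⟨G.image (L.prodMap (LinearMap.id : ℝ →ₗ[ℝ] ℝ)), ?_⟩
  rw [Finset.coe_image, ← LinearMap.image_convexHull, ← hG]
  ext ⟨x, y⟩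
  constructor
  · rintro ⟨h1, h2, h3⟩
    simp only at h1 h2 h3
    rw [hPL] at h1
    obtain ⟨l, hl, rfl⟩ := h1
    exact ⟨(l, y), ⟨hl, h2, h3⟩, rfl⟩
  · rintro ⟨⟨l, z⟩, ⟨h1, h2, h3⟩, h⟩
    obtain ⟨rfl, rfl⟩ := Prod.mk.inj h
    exact ⟨hLP l h1, h2, h3⟩
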